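/- (Convergence of Algorithm 1.) Under the Problem setup, let {(x_k, y_k, λ_k, u_k, v_k)}_{k≥1} satisfy Scheme A with λ̂_{k+1} = λ_{k+1}, and let (x*, y*, λ*) ∈ Ω. Assume α ≤ 1/L_{f2}, β ≤ t_1²/L_{g2}, and {t_k}_{k≥1} ⊆ [1, +∞) is nondecreasing with t_{k+1}² ≤ t_k² + t_{k+1} and t_{k+1}² ≤ t_k² + (β·μ_g/(1 + β·γ·‖B‖²))·t_k for all k ≥ 1. Then for all k ≥ 1: 𝓛(x_k, y_k, λ*) − 𝓛(x*, y*, λ*) ≤ (E_1 + (γ·t_2²/2)·‖B(y_1 − y*)‖²)/t_k²; ‖A x_k + B y_k − b‖ ≤ C_1/t_k²; and |f(x_k) + g(y_k) − f(x*) − g(y*)| ≤ (E_1 + (γ·t_2²/2)·‖B(y_1 − y*)‖² + C_1·‖λ*‖)/t_k², where E_1 = t_1²·(𝓛(x_1, y_1, λ*) − 𝓛(x*, y*, λ*)) + (1/(2α))·‖x_1 − x*‖² + (t_1²/(2β))·‖y_1 − y*‖² + (1/(2γ))·‖λ_1 − λ*‖² and C_1 = 3·t_1²·‖A x_1 + B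 y_1 − b‖ + (2‖λ_1 − λ*‖ + 2√(2γ·E_1 + γ²·t_2²·‖B(y_1 − y*)‖²))/γ. -/

import Mathlib

set_option autoImplicit false

open RealInnerProductSpace

/-- The Lagrangian `𝓛(x,y,λ) = f1 x + f2 x + g1 y + g2 y + ⟪λ, Ax + By − b⟫`. -/
noncomputable def Lagr {m n p : ℕ}
    (f1 f2 : EuclideanSpace ℝ (Fin m) → ℝ)
    (g1 g2 : EuclideanSpace ℝ (Fin n) → ℝ)
    (A : EuclideanSpace ℝ (Fin m) →L[ℝ] EuclideanSpace ℝ (Fin p))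
    (B : EuclideanSpace ℝ (Fin n) →L[ℝ] EuclideanSpace ℝ (Fin p))
    (b : EuclideanSpace ℝ (Fin p))
    (x : EuclideanSpace ℝ (Fin m)) (y : EuclideanSpace ℝ (Fin n))
    (l : EuclideanSpace ℝ (Fin p)) : ℝ :=
  f1 x + f2 x + g1 y + g2 y + ⟪l, A x + B y - b⟫

section Convexity

variable {E : Type*} [NormedAddCommGroup E] [InnerProductSpace ℝ E]

theorem le_of_forall_one_sub_mul_le {c d : ℝ}
    (h : ∀ s, 0 < s → s < 1 → (1 - s) * c ≤ d) : c ≤ d := by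
  have hlim : Filter.Tendsto (fun s : ℝ => (1 - s) * c) (nhdsWithin 0 (Set.Ioi 0))
      (nhds ((1 - 0) * c)) :=
    (Continuous.tendsto (by fun_prop) 0).mono_left nhdsWithin_le_nhds
  have hle := le_of_tendsto hlim (b := d) (by
    filter_upwards [Ioo_mem_nhdsGT (zero_lt_one' ℝ)] with s hs using h s hs.1 hs.2)
  simpa using hle

/-- Subgradients of a strongly convex function support it from below by a parabola. -/
theorem StrongConvexOn.subgradient_add_sq_le {g : E → ℝ} {m : ℝ}
    (hg : StrongConvexOn Set.univ m g) {v ζ : E} (hζ : ∀ z, g v + ⟪ζ, z - v⟫ ≤ g z) (z : E) :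
    g v + ⟪ζ, z - v⟫ + m / 2 * ‖z - v‖ ^ 2 ≤ g z := by
  have key : m / 2 * ‖z - v‖ ^ 2 ≤ g z - g v - ⟪ζ, z - v⟫ := by
    refine le_of_forall_one_sub_mul_le fun s hs0 hs1 => ?_
    have h1 := hg.2 (Set.mem_univ z) (Set.mem_univ v) hs0.le (sub_nonneg.2 hs1.le) (by ring)
    have h2 := hζ (s • z + (1 - s) • v)
    have h3 : s • z + (1 - s) • v - v = s • (z - v) := by module
    rw [h3, inner_smul_right] at h2
    simp only [smul_eq_mul] at h1
    refine le_of_mul_le_mul_left ?_ hs0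
    nlinarith
  linarith

/-- A minimizer of a strongly convex function is a point of quadratic growth. -/
theorem StrongConvexOn.add_sq_le_of_forall_le {g : E → ℝ} {m : ℝ}
    (hg : StrongConvexOn Set.univ m g) {v : E} (hv : ∀ z, g v ≤ g z) (z : E) :
    g v + m / 2 * ‖z - v‖ ^ 2 ≤ g z := by
  simpa using hg.subgradient_add_sq_le (ζ := 0) (by simpa using hv) z

variable [CompleteSpace E]

theorem HasGradientAt.hasDerivAt_add_smul {f : E → ℝ} {f' x d : E} {s : ℝ}
    (hf : HasGradientAt f f' (x + s • d)) : HasDerivAt (fun r : ℝ => f (x + r • d)) ⟪f', d⟫ s := by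
  have hline : HasDerivAt (fun r : ℝ => x + r • d) d s := by
    simpa using ((hasDerivAt_id s).smul_const d).const_add x
  simpa [Function.comp_def] using hf.hasFDerivAt.comp_hasDerivAt s hline

theorem ConvexOn.add_inner_gradient_le {f : E → ℝ} {f' : E → E}
    (hf : ConvexOn ℝ Set.univ f) (hf' : ∀ x, HasGradientAt f (f' x) x) (x y : E) :
    f x + ⟪f' x, y - x⟫ ≤ f y := by
  have hd : HasDerivAt (fun s : ℝ => f (x + s • (y - x))) ⟪f' x, y - x⟫ 0 := by
    simpa using (hf' (x + (0 : ℝ) • (y - x))).hasDerivAt_add_smul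
  have hc : ConvexOn ℝ Set.univ (fun s : ℝ => f (x + s • (y - x))) := by
    have := hf.comp_affineMap (AffineMap.lineMap x y)
    simpa [Function.comp_def, AffineMap.lineMap_apply, add_comm] using this
  have := hc.le_slope_of_hasDerivAt (Set.mem_univ 0) (Set.mem_univ 1) one_pos hd
  simp [slope_def_field] at this
  linarith

/-- The descent lemma for functions with Lipschitz gradient. -/
theorem le_add_inner_gradient_add_sq {f : E → ℝ} {f' : E → E} {L : ℝ}
    (hf' : ∀ x, HasGradientAt f (f' x) x) (hL : ∀ x y, ‖f' x - f' y‖ ≤ L * ‖x - y‖) (x y : E) :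
    f y ≤ f x + ⟪f' x, y - x⟫ + L / 2 * ‖y - x‖ ^ 2 := by
  have hd : ∀ s : ℝ, HasDerivAt (fun s : ℝ => f (x + s • (y - x)))
      ⟪f' (x + s • (y - x)), y - x⟫ s := fun s =>
    (hf' (x + s • (y - x))).hasDerivAt_add_smul
  have hb : ∀ s : ℝ, HasDerivAt (fun s : ℝ => f x + s * ⟪f' x, y - x⟫ + L / 2 * ‖y - x‖ ^ 2 * s ^ 2)
      (⟪f' x, y - x⟫ + L * ‖y - x‖ ^ 2 * s) s := fun s => by
    have h1 := ((hasDerivAt_id s).mul_const ⟪f' x, y - x⟫).const_add (f x)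
    have h2 := ((hasDerivAt_id s).pow 2).const_mul (L / 2 * ‖y - x‖ ^ 2)
    refine (h1.add h2).congr_deriv ?_
    simp only [id_eq, Nat.cast_ofNat]
    ring
  have := image_le_of_deriv_right_le_deriv_boundary (a := 0) (b := 1)
    (fun s _ => (hd s).continuousAt.continuousWithinAt)
    (fun s _ => (hd s).hasDerivWithinAt) (by simp)
    (fun s _ => (hb s).continuousAt.continuousWithinAt)
    (fun s _ => (hb s).hasDerivWithinAt) (fun s hs => ?_) (Set.right_mem_Icc.2 zero_le_one)
  · simpa using this
  · have h1 : ⟪f' (x + s • (y - x)) - f' x, y - x⟫ ≤ L * ‖s • (y - x)‖ * ‖y - x‖ := by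
      refine (real_inner_le_norm _ _).trans ?_
      gcongr
      simpa using hL (x + s • (y - x)) x
    rw [inner_sub_left, norm_smul, Real.norm_of_nonneg hs.1] at h1
    nlinarith

/-- One accelerated proximal gradient step for a composite function, measured by `T ^ 2` times the
function gap. -/
theorem accelerated_composite_step_le {f₁ f₂ : E → ℝ} {f' : E → E} {m L T : ℝ}
    (hf₁ : StrongConvexOn Set.univ m f₁) (hf₂ : ConvexOn ℝ Set.univ f₂)
    (hf' : ∀ x, HasGradientAt f₂ (f' x) x) (hL : ∀ x y, ‖f' x - f' y‖ ≤ L * ‖x - y‖)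
    (hT : 1 ≤ T) {x x' xbar u u' ξ : E} (hx' : T • x' = u' + (T - 1) • x)
    (hxbar : T • xbar = u + (T - 1) • x) (hξ : ∀ z, f₁ u' + ⟪ξ, z - u'⟫ ≤ f₁ z) (z : E) :
    T ^ 2 * (f₁ x' + f₂ x' - (f₁ z + f₂ z)) + T * (m / 2) * ‖u' - z‖ ^ 2 +
        (T - 1) * (m / 2) * ‖u' - x‖ ^ 2 ≤
      T * (T - 1) * (f₁ x + f₂ x - (f₁ z + f₂ z)) + T * ⟪ξ + f' xbar, u' - z⟫ +
        L / 2 * ‖u' - u‖ ^ 2 := by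
  have hT0 : 0 < T := by linarith
  have hconv : T ^ 2 * f₁ x' + (T - 1) * (m / 2) * ‖u' - x‖ ^ 2 ≤
      T * f₁ u' + T * (T - 1) * f₁ x := by
    have ha : 0 ≤ 1 / T := by positivity
    have hb : 0 ≤ 1 - 1 / T := sub_nonneg.2 (by rw [div_le_one hT0]; exact hT)
    have h := hf₁.2 (Set.mem_univ u') (Set.mem_univ x) ha hb (by ring)
    have hxe : (1 / T) • u' + (1 - 1 / T) • x = x' := by
      apply smul_right_injective E hT0.ne'
      simp only [smul_add, smul_smul, hx']
      congr 2 <;> field_simp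
      simp
    rw [hxe] at h
    simp only [smul_eq_mul] at h
    have h' := mul_le_mul_of_nonneg_left h (sq_nonneg T)
    have he : T ^ 2 * (1 / T * f₁ u' + (1 - 1 / T) * f₁ x -
        1 / T * (1 - 1 / T) * (m / 2 * ‖u' - x‖ ^ 2)) =
        T * f₁ u' + T * (T - 1) * f₁ x - (T - 1) * (m / 2) * ‖u' - x‖ ^ 2 := by
      field_simp
    linarith
  have hsub := hf₁.subgradient_add_sq_le hξ z
  have hdesc := le_add_inner_gradient_add_sq hf' hL xbar x'
  have hgx := hf₂.add_inner_gradient_le hf' xbar x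
  have hgz := hf₂.add_inner_gradient_le hf' xbar z
  have hdiff : T • (x' - xbar) = u' - u := by rw [smul_sub, hx', hxbar]; abel
  have hsq : T ^ 2 * ‖x' - xbar‖ ^ 2 = ‖u' - u‖ ^ 2 := by
    rw [← hdiff, norm_smul, Real.norm_of_nonneg hT0.le]; ring
  have hin : T ^ 2 * ⟪f' xbar, x' - xbar⟫ = T * (T - 1) * ⟪f' xbar, x - xbar⟫ +
      T * ⟪f' xbar, z - xbar⟫ + T * ⟪f' xbar, u' - z⟫ := by
    have hv : T • (x' - xbar) = (T - 1) • (x - xbar) + (z - xbar) + (u' - z) := by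
      rw [smul_sub, hx']; module
    have := congrArg (fun w => T * ⟪f' xbar, w⟫) hv
    simp only [inner_add_right, inner_smul_right] at this
    linarith
  have hzz : ⟪ξ, z - u'⟫ = -⟪ξ, u' - z⟫ := by rw [← neg_sub u' z, inner_neg_right]
  rw [hzz, norm_sub_rev] at hsub
  rw [inner_add_left]
  have h1 := mul_le_mul_of_nonneg_left hdesc (sq_nonneg T)
  have h2 := mul_le_mul_of_nonneg_left hgx (mul_nonneg hT0.le (sub_nonneg.2 hT))
  have h3 := mul_le_mul_of_nonneg_left hgz hT0.le
  have h4 := mul_le_mul_of_nonneg_left hsub hT0.le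
  have h5 : T ^ 2 * (L / 2 * ‖x' - xbar‖ ^ 2) = L / 2 * ‖u' - u‖ ^ 2 := by rw [← hsq]; ring
  linarith

end Convexity

section PrimalDual

variable {E F G : Type*} [NormedAddCommGroup E] [InnerProductSpace ℝ E] [CompleteSpace E]
  [NormedAddCommGroup F] [InnerProductSpace ℝ F] [CompleteSpace F]
  [NormedAddCommGroup G] [InnerProductSpace ℝ G] [CompleteSpace G]

theorem two_mul_inner_sub_self_left {V : Type*} [NormedAddCommGroup V] [InnerProductSpace ℝ V]
    (x y : V) : 2 * ⟪x - y, x⟫ = ‖x - y‖ ^ 2 + ‖x‖ ^ 2 - ‖y‖ ^ 2 := by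
  rw [norm_sub_sq_real, inner_sub_left, real_inner_self_eq_norm_sq, real_inner_comm]
  ring

/-- The coupled primal and dual updates of the scheme, in coordinates centred at a saddle point:
`p, w, l` are the primal and dual errors and `l₀` is the dual solution. -/
theorem coupled_step_le (A : E →L[ℝ] G) (B : F →L[ℝ] G) {α β γ T : ℝ} (hα : 0 < α) (hβ : 0 < β)
    (hγ : 0 < γ) (hT : 0 < T) {p p' a : E} {w w' c : F} {l l' lbar l₀ : G}
    (hp : p' - p = -((α * T) • (a + ContinuousLinearMap.adjoint A (l₀ + lbar))))
    (hw : w' - w = -((β / T) • (c + ContinuousLinearMap.adjoint B (l₀ + l'))))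
    (hl : l' = l + (γ * T) • (A p' + B w')) (hlbar : lbar = l + (γ * T) • (A p' + B w)) :
    T * ⟪a, p'⟫ + T * ⟪c, w'⟫ + T * ⟪l₀, A p' + B w'⟫ + 1 / (2 * α) * ‖p'‖ ^ 2 +
        1 / (2 * γ) * ‖l'‖ ^ 2 + T ^ 2 / (2 * β) * ‖w'‖ ^ 2 + γ * T ^ 2 / 2 * ‖B w'‖ ^ 2 +
        1 / (2 * α) * ‖p' - p‖ ^ 2 + T ^ 2 / (2 * β) * ‖w' - w‖ ^ 2 ≤
      1 / (2 * α) * ‖p‖ ^ 2 + 1 / (2 * γ) * ‖l‖ ^ 2 + T ^ 2 / (2 * β) * ‖w‖ ^ 2 +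
        γ * T ^ 2 / 2 * ‖B w‖ ^ 2 := by
  have e1 : T * ⟪a, p'⟫ = -(1 / (2 * α)) * (‖p' - p‖ ^ 2 + ‖p'‖ ^ 2 - ‖p‖ ^ 2) -
      T * ⟪l₀ + lbar, A p'⟫ := by
    rw [← two_mul_inner_sub_self_left, hp, inner_neg_left, inner_smul_left, inner_add_left,
      ContinuousLinearMap.adjoint_inner_left]
    simp only [conj_trivial]
    field_simp
    ring
  have e2 : T * ⟪c, w'⟫ = -(T ^ 2 / (2 * β)) * (‖w' - w‖ ^ 2 + ‖w'‖ ^ 2 - ‖w‖ ^ 2) -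
      T * ⟪l₀ + l', B w'⟫ := by
    rw [← two_mul_inner_sub_self_left, hw, inner_neg_left, inner_smul_left, inner_add_left,
      ContinuousLinearMap.adjoint_inner_left]
    simp only [conj_trivial]
    field_simp
    ring
  have hls : l' - l = (γ * T) • (A p' + B w') := by rw [hl]; abel
  have e3 : T * ⟪l', A p' + B w'⟫ = 1 / (2 * γ) * (‖l'‖ ^ 2 - ‖l‖ ^ 2) +
      γ * T ^ 2 / 2 * ‖A p' + B w'‖ ^ 2 := by
    have h := two_mul_inner_sub_self_left l' l
    rw [hls, norm_smul, inner_smul_left, Real.norm_of_nonneg (by positivity),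
      real_inner_comm] at h
    simp only [conj_trivial] at h
    field_simp
    linarith
  have hlb : lbar = l' - (γ * T) • (B w' - B w) := by rw [hl, hlbar]; module
  have e4 := two_mul_inner_sub_self_left (B w') (B w)
  have e5 : 2 * ⟪B w' - B w, A p' + B w'⟫ ≤ ‖B w' - B w‖ ^ 2 + ‖A p' + B w'‖ ^ 2 := by
    have := norm_sub_sq_real (B w' - B w) (A p' + B w')
    nlinarith [sq_nonneg ‖B w' - B w - (A p' + B w')‖]
  rw [e1, e2, hlb]
  simp only [inner_add_left, inner_add_right, inner_sub_left, inner_smul_left, conj_trivial]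
    at e3 e4 e5 ⊢
  have hc : 0 ≤ γ * T ^ 2 / 2 := by positivity
  have e5' := mul_le_mul_of_nonneg_left e5 hc
  have e4' := congrArg (fun r => γ * T ^ 2 / 2 * r) e4
  linarith

/-- One step of the accelerated linearized alternating direction method of multipliers, measured by
`T ^ 2` times the Lagrangian gap plus squared distances to a solution. -/
theorem admm_step_le {f₁ f₂ : E → ℝ} {g₁ g₂ : F → ℝ} {f' : E → E} {g' : F → F} {Lf Lg μ : ℝ}
    (hf₁ : ConvexOn ℝ Set.univ f₁) (hf₂ : ConvexOn ℝ Set.univ f₂)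
    (hf' : ∀ x, HasGradientAt f₂ (f' x) x) (hLf : ∀ x y, ‖f' x - f' y‖ ≤ Lf * ‖x - y‖)
    (hg₁ : StrongConvexOn Set.univ μ g₁) (hg₂ : ConvexOn ℝ Set.univ g₂)
    (hg' : ∀ y, HasGradientAt g₂ (g' y) y) (hLg : ∀ x y, ‖g' x - g' y‖ ≤ Lg * ‖x - y‖)
    (A : E →L[ℝ] G) (B : F →L[ℝ] G) {b : G} {α β γ T : ℝ} (hα : 0 < α) (hβ : 0 < β)
    (hγ : 0 < γ) (hT : 1 ≤ T) (hαLf : α * Lf ≤ 1)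
    {x x' xbar u u' ξ xs : E} {y y' ybar v v' ζ ys : F} {l l' lbar ls : G}
    (hs : A xs + B ys = b)
    (hx' : T • x' = u' + (T - 1) • x) (hxbar : T • xbar = u + (T - 1) • x)
    (hy' : T • y' = v' + (T - 1) • y) (hybar : T • ybar = v + (T - 1) • y)
    (hξ : ∀ z, f₁ u' + ⟪ξ, z - u'⟫ ≤ f₁ z) (hζ : ∀ z, g₁ v' + ⟪ζ, z - v'⟫ ≤ g₁ z)
    (hu : u' - u = -((α * T) • (ξ + f' xbar + ContinuousLinearMap.adjoint A lbar)))
    (hv : v' - v = -((β / T) • (ζ + g' ybar + ContinuousLinearMap.adjoint B l')))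
    (hl : l' = l + (γ * T) • (A u' + B v' - b))
    (hlbar : lbar = l + (γ * T) • (A u' + B v - b)) :
    T ^ 2 * (f₁ x' + f₂ x' - (f₁ xs + f₂ xs) + (g₁ y' + g₂ y' - (g₁ ys + g₂ ys)) +
          ⟪ls, A x' + B y' - b⟫) +
        1 / (2 * α) * ‖u' - xs‖ ^ 2 + 1 / (2 * γ) * ‖l' - ls‖ ^ 2 +
        (T ^ 2 / β + T * μ) / 2 * ‖v' - ys‖ ^ 2 + γ * T ^ 2 / 2 * ‖B (v' - ys)‖ ^ 2 +
        (T - 1) * (μ / 2) * ‖v' - y‖ ^ 2 + (T ^ 2 / β - Lg) / 2 * ‖v' - v‖ ^ 2 ≤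
      T * (T - 1) * (f₁ x + f₂ x - (f₁ xs + f₂ xs) + (g₁ y + g₂ y - (g₁ ys + g₂ ys)) +
          ⟪ls, A x + B y - b⟫) +
        1 / (2 * α) * ‖u - xs‖ ^ 2 + 1 / (2 * γ) * ‖l - ls‖ ^ 2 +
        T ^ 2 / (2 * β) * ‖v - ys‖ ^ 2 + γ * T ^ 2 / 2 * ‖B (v - ys)‖ ^ 2 := by
  have hT0 : 0 < T := by linarith
  have hF := accelerated_composite_step_le (strongConvexOn_zero.2 hf₁) hf₂ hf' hLf hT hx' hxbar
    hξ xs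
  have hG := accelerated_composite_step_le hg₁ hg₂ hg' hLg hT hy' hybar hζ ys
  have hs' : A (u' - xs) + B (v' - ys) = A u' + B v' - b := by
    rw [← hs, map_sub, map_sub]; abel
  have hs'' : A (u' - xs) + B (v - ys) = A u' + B v - b := by
    rw [← hs, map_sub, map_sub]; abel
  have hC := coupled_step_le A B hα hβ hγ hT0 (p := u - xs) (p' := u' - xs) (a := ξ + f' xbar)
    (w := v - ys) (w' := v' - ys) (c := ζ + g' ybar) (l := l - ls) (l' := l' - ls)
    (lbar := lbar - ls) (l₀ := ls) (by simpa using hu) (by simpa using hv)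
    (by rw [hs', hl]; abel) (by rw [hs'', hlbar]; abel)
  rw [hs', sub_sub_sub_cancel_right, sub_sub_sub_cancel_right] at hC
  have hr : T ^ 2 * ⟪ls, A x' + B y' - b⟫ =
      T * (T - 1) * ⟪ls, A x + B y - b⟫ + T * ⟪ls, A u' + B v' - b⟫ := by
    have h : T • (A x' + B y' - b) = (T - 1) • (A x + B y - b) + (A u' + B v' - b) := by
      rw [smul_sub, smul_add, ← map_smul, ← map_smul, hx', hy']
      simp only [map_add, map_smul]
      module
    have := congrArg (fun r => T * ⟪ls, r⟫) h
    simp only [inner_add_right, inner_smul_right] at this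
    linarith
  have hLf' : Lf / 2 * ‖u' - u‖ ^ 2 ≤ 1 / (2 * α) * ‖u' - u‖ ^ 2 := by
    gcongr ?_ * _
    rw [div_le_div_iff₀ two_pos (by positivity)]
    linarith
  have hid : (T ^ 2 / β + T * μ) / 2 * ‖v' - ys‖ ^ 2 =
      T ^ 2 / (2 * β) * ‖v' - ys‖ ^ 2 + T * (μ / 2) * ‖v' - ys‖ ^ 2 := by field_simp
  have hid' : (T ^ 2 / β - Lg) / 2 * ‖v' - v‖ ^ 2 =
      T ^ 2 / (2 * β) * ‖v' - v‖ ^ 2 - Lg / 2 * ‖v' - v‖ ^ 2 := by field_simp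
  rw [hid, hid']
  linarith

end PrimalDual

section Scalar

/-- The weight on the squared distance to the solution in the bound on the energy deficit, where
`τ` and `T₂` are the first two step parameters and `T` is the current one. -/
noncomputable def deficitWeight (τ T₂ T : ℝ) : ℝ :=
  (T₂ - τ) * (T₂ + τ - 1) + 17 / 20 * (T - T₂)

theorem deficitWeight_nonneg {τ T₂ T : ℝ} (hτ : 1 ≤ τ) (h₂ : τ ≤ T₂) (hT : T₂ ≤ T) :
    0 ≤ deficitWeight τ T₂ T := by
  have h1 := mul_nonneg (sub_nonneg.2 h₂) (by linarith : 0 ≤ T₂ + τ - 1)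
  unfold deficitWeight
  linarith

theorem deficitWeight_le {τ T₂ T : ℝ} (hτ : 1 ≤ τ) (h₂ : τ ≤ T₂) (h₂' : T₂ ^ 2 ≤ τ ^ 2 + T₂)
    (hT : T₂ ≤ T) : deficitWeight τ T₂ T ≤ T - 1 / 2 - 1 / (9 * T) := by
  have hT₂ : 0 < T₂ := by linarith
  have h1 : 1 / (9 * T) ≤ 1 / (9 * T₂) := by gcongr
  have h3 : 1 / (9 * T₂) ≤ T₂ - (T₂ - τ) * (T₂ + τ - 1) - 1 / 2 := by
    rw [div_le_iff₀ (by positivity)]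
    obtain ⟨p, hp, rfl⟩ : ∃ p, 0 ≤ p ∧ T₂ = τ + p := ⟨T₂ - τ, by linarith, by ring⟩
    rcases le_total 1 (9 * (τ + p) * (p - 1 / 2)) with h | h
    · nlinarith
    · nlinarith [mul_nonneg (by linarith : 0 ≤ τ + p - 1) (sub_nonneg.2 h), sq_nonneg (p - 1 / 2),
        mul_nonneg hT₂.le (sq_nonneg (p - 1 / 2))]
  unfold deficitWeight
  linarith

theorem half_mul_le_of_mul_eq {T d σ : ℝ} (hT : 1 ≤ T) (hd : 0 ≤ d) (hσ : 0 ≤ σ) (hσ' : σ ≤ 1)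
    (h : d * (2 * T + d) = σ * (T + d)) : σ / 2 * (1 + σ / (4 * T + 1)) ≤ d := by
  obtain ⟨ε, hε⟩ : ∃ ε, ε = σ / (4 * T + 1) := ⟨_, rfl⟩
  have hε' : ε * (4 * T + 1) = σ := by rw [hε]; field_simp
  have hε0 : 0 ≤ ε := by rw [hε]; positivity
  rw [← hε]
  by_contra! hlt
  have h0 : σ ^ 2 / 4 * (1 + ε) ^ 2 + (2 * T - σ) * (σ / 2 * (1 + ε)) - σ * T ≤ 0 := by
    have : σ ^ 2 / 4 * (1 + ε) ^ 2 + (2 * T - σ) * (σ / 2 * (1 + ε)) - σ * T =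
        -(σ * ε / 4) * (1 - σ * ε) := by
      have hT' : T * ε = (σ - ε) / 4 := by linarith
      linear_combination σ * hT'
    rw [this]
    have : σ * ε ≤ 1 := by
      have : ε ≤ 1 := by rw [hε, div_le_one (by linarith)]; linarith
      nlinarith
    nlinarith [mul_nonneg hσ hε0, mul_nonneg (mul_nonneg hσ hε0) (sub_nonneg.2 this)]
  nlinarith [mul_pos (sub_pos.2 hlt) (by linarith : 0 < 2 * T - σ)]

theorem le_coeff_sq_left {T f d σ : ℝ} (hT : 1 ≤ T) (hσ : 0 ≤ σ) (hσ' : σ ≤ 1)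
    (hf : f ≤ T - 1 / 2 - 1 / (9 * T)) (hd : σ / 2 * (1 + σ / (4 * T + 1)) ≤ d) :
    17 / 40 * ((4 * T + 2) / (4 * T + 1)) ≤
      (1 - σ) * (T + d) + σ * (f + 17 / 20 * d) - f := by
  obtain ⟨ε, hε⟩ : ∃ ε, ε = 1 / (4 * T + 1) := ⟨_, rfl⟩
  obtain ⟨r, hr⟩ : ∃ r, r = 1 / (9 * T) := ⟨_, rfl⟩
  have hε' : σ / (4 * T + 1) = σ * ε := by rw [hε]; ring
  have hε'' : (4 * T + 2) / (4 * T + 1) = 1 + ε := by rw [hε]; field_simp; ring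
  have hε0 : 0 ≤ ε := by rw [hε]; positivity
  rw [← hr] at hf
  rw [hε'] at hd
  rw [hε'']
  have h0 : 17 / 40 * ε ≤ 3 / 40 + r := by
    rw [hε, hr, mul_one_div, div_add_div _ _ (by positivity) (by positivity),
      div_le_div_iff₀ (by positivity) (by positivity)]
    nlinarith
  have h1 : 51 / 40 * ε ≤ 3 / 20 + r := by
    rw [hε, hr, mul_one_div, div_add_div _ _ (by positivity) (by positivity),
      div_le_div_iff₀ (by positivity) (by positivity)]
    nlinarith [sq_nonneg (T - 1)]
  have h2 : 17 / 40 * ε * (1 + σ + σ ^ 2) ≤ 3 / 40 * (1 + σ) + r := by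
    have : σ ^ 2 ≤ σ := by nlinarith
    have := mul_le_mul_of_nonneg_left this hε0
    nlinarith [mul_le_mul_of_nonneg_left h0 (sub_nonneg.2 hσ'), mul_le_mul_of_nonneg_left h1 hσ]
  have h3 : σ / 2 ≤ d := by nlinarith [mul_nonneg hσ (mul_nonneg hσ hε0)]
  have h4 : 1 / 2 + σ / 2 + r ≤ T + d - f := by linarith
  have h5 := mul_le_mul_of_nonneg_left h4 (sub_nonneg.2 hσ')
  have h6 := mul_le_mul_of_nonneg_left h2 (sub_nonneg.2 hσ')
  have h7 := mul_le_mul_of_nonneg_left hd hσ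
  nlinarith

theorem sq_le_coeff_mul_coeff {T g : ℝ} (hT : 1 ≤ T) (hg : 1 ≤ g) (hg' : g ≤ (T + 1) / 2) :
    ((T - 1 / 2 - 1 / (9 * T)) / T) ^ 2 ≤ 17 / 40 * ((4 * T + 2) / (4 * T + 1)) *
      (T - 1 - (T - 1 / 2 - 1 / (9 * T)) / T ^ 2 + g * (1 - 2 * (1 - 1 / T) ^ 2)) := by
  have hT0 : 0 < T := by linarith
  have key : (T ^ 2 - T / 2 - 1 / 9) ^ 2 * (4 * T + 1) ≤ 17 / 40 * (4 * T + 2) *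
      (T ^ 3 * (T - 1) - (T ^ 2 - T / 2 - 1 / 9) + g * T * (T ^ 2 - 2 * (T - 1) ^ 2)) * T := by
    have hpoly₁ : (T ^ 2 - T / 2 - 1 / 9) ^ 2 * (4 * T + 1) ≤ 17 / 40 * (4 * T + 2) *
        (T ^ 3 * (T - 1) - (T ^ 2 - T / 2 - 1 / 9) + T * (T ^ 2 - 2 * (T - 1) ^ 2)) * T := by
      obtain ⟨r, hr, rfl⟩ : ∃ r, 0 ≤ r ∧ T = 1 + r := ⟨T - 1, by linarith, by ring⟩
      rw [← sub_nonneg]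
      rcases le_total r (1 / 2) with h | h
      · have h2 : r ^ 2 ≤ r / 2 := by nlinarith
        have h3 : r ^ 3 ≤ r / 4 := by nlinarith
        have h4 : r ^ 4 ≤ r / 8 := by nlinarith
        have h5 : 0 ≤ r ^ 5 := by positivity
        have h6 : 0 ≤ r ^ 6 := by positivity
        nlinarith
      rcases le_total r 1 with h' | h'
      · obtain ⟨q, hq, rfl⟩ : ∃ q, 0 ≤ q ∧ r = 1 / 2 + q := ⟨r - 1 / 2, by linarith, by ring⟩
        have h2 : q ^ 2 ≤ q / 2 := by nlinarith
        have h3 : 0 ≤ q ^ 3 := by positivity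
        have h4 : 0 ≤ q ^ 4 := by positivity
        have h5 : 0 ≤ q ^ 5 := by positivity
        have h6 : 0 ≤ q ^ 6 := by positivity
        nlinarith
      · obtain ⟨q, hq, rfl⟩ : ∃ q, 0 ≤ q ∧ r = 1 + q := ⟨r - 1, by linarith, by ring⟩
        ring_nf
        positivity
    have hpoly₂ : (T ^ 2 - T / 2 - 1 / 9) ^ 2 * (4 * T + 1) ≤ 17 / 40 * (4 * T + 2) *
        (T ^ 3 * (T - 1) - (T ^ 2 - T / 2 - 1 / 9) +
          (T + 1) / 2 * T * (T ^ 2 - 2 * (T - 1) ^ 2)) * T := by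
      obtain ⟨r, hr, rfl⟩ : ∃ r, 0 ≤ r ∧ T = 1 + r := ⟨T - 1, by linarith, by ring⟩
      rw [← sub_nonneg]
      ring_nf
      positivity
    have hc : 0 ≤ 17 / 40 * (4 * T + 2) * T * T := by positivity
    rcases le_total 0 (T ^ 2 - 2 * (T - 1) ^ 2) with h | h
    · nlinarith [mul_nonneg hc (mul_nonneg (sub_nonneg.2 hg) h)]
    · nlinarith [mul_nonneg hc (mul_nonneg (sub_nonneg.2 hg') (neg_nonneg.2 h))]
  have e1 : ((T - 1 / 2 - 1 / (9 * T)) / T) ^ 2 =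
      (T ^ 2 - T / 2 - 1 / 9) ^ 2 * (4 * T + 1) / (T ^ 4 * (4 * T + 1)) := by
    field_simp
  have e2 : 17 / 40 * ((4 * T + 2) / (4 * T + 1)) *
      (T - 1 - (T - 1 / 2 - 1 / (9 * T)) / T ^ 2 + g * (1 - 2 * (1 - 1 / T) ^ 2)) =
      17 / 40 * (4 * T + 2) * (T ^ 3 * (T - 1) - (T ^ 2 - T / 2 - 1 / 9) +
        g * T * (T ^ 2 - 2 * (T - 1) ^ 2)) * T / (T ^ 4 * (4 * T + 1)) := by
    field_simp
  rw [e1, e2]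
  gcongr

theorem quadratic_coeffs_nonneg {τ T₂ : ℝ} (hτ : 1 ≤ τ) (h₂ : τ ≤ T₂)
    (h₂' : T₂ ^ 2 ≤ τ ^ 2 + T₂) :
    0 ≤ T₂ * (23 / 20 * τ - 7 / 10) + (τ - 1) * (τ - 17 / 20) / 2 -
        (T₂ - τ) * (T₂ + τ - 1) * τ + 3 / 10 ∧
      0 ≤ (T₂ + (τ - 1) / 2) * T₂ * (1 + τ) -
        (T₂ - τ) * (T₂ + τ - 1) * (2 * T₂ + (τ - 1) / 2 + τ * T₂) - 3 / 20 := by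
  obtain ⟨s, hs, rfl⟩ : ∃ s, 0 ≤ s ∧ τ = 1 + s := ⟨τ - 1, by linarith, by ring⟩
  obtain ⟨p, h0, rfl⟩ : ∃ p, 0 ≤ p ∧ T₂ = 1 + s + p := ⟨T₂ - (1 + s), by linarith, by ring⟩
  rcases le_total p (3 / 5) with hp | hp
  · constructor
    · nlinarith [mul_nonneg hs (sub_nonneg.2 hp), mul_nonneg h0 (sub_nonneg.2 hp),
        mul_nonneg hs (mul_nonneg h0 (sub_nonneg.2 hp)),
        mul_nonneg hs (mul_nonneg hs (sub_nonneg.2 hp))]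
    · obtain ⟨q, hq, rfl⟩ : ∃ q, 0 ≤ q ∧ p = 3 / 5 - q := ⟨3 / 5 - p, by linarith, by ring⟩
      have hq' : 0 ≤ 3 / 5 - q := by linarith
      nlinarith [mul_nonneg hs hq, mul_nonneg hs hq', mul_nonneg hq hq',
        mul_nonneg hs (mul_nonneg hq hq'), mul_nonneg hs hs, mul_nonneg hs (mul_nonneg hs hq),
        mul_nonneg hs (mul_nonneg hs hs), mul_nonneg hs (mul_nonneg hs (mul_nonneg hs hq)),
        mul_nonneg hs (mul_nonneg hs (mul_nonneg hq hq')), mul_nonneg hq (mul_nonneg hq hq'),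
        mul_nonneg hs (mul_nonneg hq (mul_nonneg hq hq'))]
  · have hθ : (1 + s + p - (1 + s)) * (1 + s + p + (1 + s) - 1) ≤ 1 + s := by nlinarith
    obtain ⟨q, hq, rfl⟩ : ∃ q, 0 ≤ q ∧ p = 3 / 5 + q := ⟨p - 3 / 5, by linarith, by ring⟩
    obtain ⟨θ, hθe⟩ : ∃ θ, θ = (1 + s + (3 / 5 + q) - (1 + s)) *
      (1 + s + (3 / 5 + q) + (1 + s) - 1) := ⟨_, rfl⟩
    rw [← hθe] at hθ ⊢
    constructor
    · nlinarith [mul_nonneg hs hq, mul_nonneg hs (sub_nonneg.2 hθ)]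
    · have h1 : 0 ≤ 2 * (1 + s + (3 / 5 + q)) + (1 + s - 1) / 2 +
          (1 + s) * (1 + s + (3 / 5 + q)) := by
        rw [add_sub_cancel_left]
        positivity
      have h2 : 0 ≤ (1 + s + (3 / 5 + q) + (1 + s - 1) / 2) * (1 + s + (3 / 5 + q)) *
          (1 + (1 + s)) - (1 + s) * (2 * (1 + s + (3 / 5 + q)) + (1 + s - 1) / 2 +
            (1 + s) * (1 + s + (3 / 5 + q))) - 3 / 20 := by
        ring_nf
        positivity
      linarith [mul_nonneg (sub_nonneg.2 hθ) h1]

theorem deficitWeight_mul_add_le {τ T₂ T P : ℝ} (hτ : 1 ≤ τ) (h₂ : τ ≤ T₂)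
    (h₂' : T₂ ^ 2 ≤ τ ^ 2 + T₂) (hT : T₂ ≤ T) (hP : P = T + T ^ 2 * τ / T₂) :
    deficitWeight τ T₂ T * (T - 1 + (τ + 1) / 2 + P) ≤ (T - 1 + (τ + 1) / 2) * P := by
  have hT₂ : 0 < T₂ := by linarith
  have hT0 : 0 < T := by linarith
  have hf := deficitWeight_nonneg hτ h₂ hT
  obtain ⟨hc₁, hc₀⟩ := quadratic_coeffs_nonneg hτ h₂ h₂'
  obtain ⟨θ, hθ⟩ : ∃ θ, θ = (T₂ - τ) * (T₂ + τ - 1) := ⟨_, rfl⟩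
  obtain ⟨q, hq, rfl⟩ : ∃ q, 0 ≤ q ∧ T = T₂ + q := ⟨T - T₂, by linarith, by ring⟩
  have hf' : deficitWeight τ T₂ (T₂ + q) = θ + 17 / 20 * q := by
    rw [hθ, deficitWeight, add_sub_cancel_left]
  rw [← hθ] at hc₁ hc₀
  have h1 : deficitWeight τ T₂ (T₂ + q) * (T₂ + (τ - 1) / 2 + T₂ + τ * (T₂ + q)) ≤
      (T₂ + q - 1 + (τ + 1) / 2) * (T₂ + τ * (T₂ + q)) := by
    rw [hf']
    nlinarith [mul_nonneg hc₁ hq, sq_nonneg (q - 1), mul_nonneg (sub_nonneg.2 hτ) (sq_nonneg q)]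
  have h2 : deficitWeight τ T₂ (T₂ + q) * ((T₂ + q - 1 + (τ + 1) / 2) * T₂) ≤
      deficitWeight τ T₂ (T₂ + q) * ((T₂ + q) * (T₂ + (τ - 1) / 2)) := by
    refine mul_le_mul_of_nonneg_left ?_ hf
    nlinarith [mul_nonneg hq (sub_nonneg.2 hτ)]
  have hPe : P * T₂ = (T₂ + q) * (T₂ + τ * (T₂ + q)) := by
    rw [hP]
    field_simp
  refine le_of_mul_le_mul_right ?_ hT₂
  have h3 := mul_le_mul_of_nonneg_left h1 hT0.le
  calc _ = deficitWeight τ T₂ (T₂ + q) * ((T₂ + q - 1 + (τ + 1) / 2) * T₂) +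
        deficitWeight τ T₂ (T₂ + q) * (P * T₂) := by ring
    _ ≤ (T₂ + q - 1 + (τ + 1) / 2) * (P * T₂) := by rw [hPe]; linarith
    _ = _ := by ring

end Scalar

section QuadraticForms

variable {V : Type*} [NormedAddCommGroup V] [InnerProductSpace ℝ V]

theorem quadratic_form_nonneg {a c r : ℝ} (ha : 0 < a) (h : c ^ 2 ≤ a * r) (z e : V) :
    0 ≤ a * ‖z‖ ^ 2 + 2 * c * ⟪z, e⟫ + r * ‖e‖ ^ 2 := by
  have h1 := norm_add_sq_real (a • z) (c • e)
  rw [norm_smul, norm_smul, inner_smul_left, inner_smul_right, mul_pow, mul_pow, Real.norm_eq_abs,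
    Real.norm_eq_abs, sq_abs, sq_abs] at h1
  simp only [conj_trivial] at h1
  refine nonneg_of_mul_nonneg_right ?_ ha
  nlinarith [mul_nonneg (sub_nonneg.2 h) (sq_nonneg ‖e‖), sq_nonneg ‖a • z + c • e‖]

theorem mul_sq_norm_sub_smul_ge {D σ g κ : ℝ} (hg : 0 ≤ g) (hD : (1 + σ) * g ≤ D) (e e' : V) :
    -(σ * (1 + σ) * g * κ ^ 2) * ‖e‖ ^ 2 ≤ D * ‖e' - κ • e‖ ^ 2 - σ * g * ‖e'‖ ^ 2 := by
  have h1 : (1 + σ) * g * ‖e' - κ • e‖ ^ 2 ≤ D * ‖e' - κ • e‖ ^ 2 := by gcongr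
  have h2 := norm_sub_sq_real e' (κ • e)
  have h3 := norm_sub_sq_real e' (((1 + σ) * κ) • e)
  rw [norm_smul, inner_smul_right, mul_pow, Real.norm_eq_abs, sq_abs] at h2 h3
  have h4 := mul_nonneg hg (sq_nonneg ‖e' - ((1 + σ) * κ) • e‖)
  rw [h3] at h4
  rw [h2] at h1 ⊢
  linarith

/-- The quadratic form controlling the change of the deficit along one step is nonnegative. -/
theorem deficit_step_nonneg {τ T₂ T T' σ : ℝ} (hτ : 1 ≤ τ) (h₂ : τ ≤ T₂)
    (h₂' : T₂ ^ 2 ≤ τ ^ 2 + T₂) (hT : T₂ ≤ T) (hT' : T ≤ T') (hσ : 0 ≤ σ) (hσ' : σ ≤ 1)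
    (h : T' ^ 2 - T ^ 2 = σ * T') (z e e' : V) :
    0 ≤ -deficitWeight τ T₂ T * ‖z - (1 / T) • e‖ ^ 2 + (T - 1 + (τ + 1) / 2) * ‖e‖ ^ 2 +
      (1 - σ) * T' * ‖z‖ ^ 2 + τ * (1 + σ) * ‖e' - (1 - 1 / T) • e‖ ^ 2 +
      σ * deficitWeight τ T₂ T' * ‖z‖ ^ 2 - σ * ((τ + 1) / 2) * ‖e'‖ ^ 2 := by
  have hT1 : 1 ≤ T := by linarith
  have hT0 : 0 < T := by linarith
  obtain ⟨d, hd, rfl⟩ : ∃ d, 0 ≤ d ∧ T' = T + d := ⟨T' - T, by linarith, by ring⟩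
  have hw : deficitWeight τ T₂ (T + d) = deficitWeight τ T₂ T + 17 / 20 * d := by
    unfold deficitWeight; ring
  have hf0 := deficitWeight_nonneg hτ h₂ hT
  have hf := deficitWeight_le hτ h₂ h₂' hT
  rw [hw]
  generalize deficitWeight τ T₂ T = f at hf0 hf ⊢
  have hd' := half_mul_le_of_mul_eq hT1 hd hσ hσ' (by linarith)
  have hZ := le_coeff_sq_left hT1 hσ hσ' hf hd'
  have hZR := sq_le_coeff_mul_coeff (g := (τ + 1) / 2) hT1 (by linarith) (by linarith)
  have hZ0 : 0 < 17 / 40 * ((4 * T + 2) / (4 * T + 1)) := by positivity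
  have hR : T - 1 - (T - 1 / 2 - 1 / (9 * T)) / T ^ 2 +
      (τ + 1) / 2 * (1 - 2 * (1 - 1 / T) ^ 2) ≤
      T - 1 + (τ + 1) / 2 - f / T ^ 2 - σ * (1 + σ) * ((τ + 1) / 2) * (1 - 1 / T) ^ 2 := by
    have h1 : f / T ^ 2 ≤ (T - 1 / 2 - 1 / (9 * T)) / T ^ 2 := by gcongr
    have h2 : σ * (1 + σ) ≤ 2 := by nlinarith
    have h3 : 0 ≤ (τ + 1) / 2 * (1 - 1 / T) ^ 2 := by positivity
    nlinarith [mul_le_mul_of_nonneg_right h2 h3]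
  have hsq : (f / T) ^ 2 ≤ ((T - 1 / 2 - 1 / (9 * T)) / T) ^ 2 := by gcongr
  have hR0 : 0 ≤ T - 1 - (T - 1 / 2 - 1 / (9 * T)) / T ^ 2 +
      (τ + 1) / 2 * (1 - 2 * (1 - 1 / T) ^ 2) :=
    nonneg_of_mul_nonneg_right ((sq_nonneg _).trans hZR) hZ0
  have hQ := quadratic_form_nonneg (hZ0.trans_le hZ)
    ((hsq.trans hZR).trans (mul_le_mul hZ hR hR0 (hZ0.le.trans hZ))) z e
  have hE := mul_sq_norm_sub_smul_ge (D := τ * (1 + σ)) (σ := σ) (g := (τ + 1) / 2)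
    (κ := 1 - 1 / T) (by linarith) (by nlinarith) e e'
  have hz := norm_sub_sq_real z ((1 / T) • e)
  rw [norm_smul, inner_smul_right, mul_pow, Real.norm_eq_abs, sq_abs] at hz
  rw [hz]
  have e1 : f / T ^ 2 * ‖e‖ ^ 2 = f * ((1 / T) ^ 2 * ‖e‖ ^ 2) := by field_simp
  have e2 : 2 * (f / T) * ⟪z, e⟫ = f * (2 * (1 / T * ⟪z, e⟫)) := by field_simp
  linarith

theorem deficit_final_nonneg {τ T₂ T : ℝ} (hτ : 1 ≤ τ) (h₂ : τ ≤ T₂)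
    (h₂' : T₂ ^ 2 ≤ τ ^ 2 + T₂) (hT : T₂ ≤ T) (z e : V) :
    0 ≤ -deficitWeight τ T₂ T * ‖z‖ ^ 2 + (T - 1 + (τ + 1) / 2) * ‖e‖ ^ 2 +
      (T + T ^ 2 * τ / T₂) * ‖z + e‖ ^ 2 := by
  have hT0 : 0 < T := by linarith
  have hf := deficitWeight_le hτ h₂ h₂' hT
  have hP := deficitWeight_mul_add_le hτ h₂ h₂' hT rfl
  have hP' : 0 ≤ T ^ 2 * τ / T₂ := by have : 0 < T₂ := by linarith
                                      positivity
  have hT' : 0 < 1 / (9 * T) := by positivity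
  generalize T ^ 2 * τ / T₂ = P at hP hP' ⊢
  have hQ := quadratic_form_nonneg (a := T + P - deficitWeight τ T₂ T) (c := T + P)
    (r := T - 1 + (τ + 1) / 2 + (T + P)) (by linarith) (by linarith) z e
  rw [norm_add_sq_real]
  linarith

end QuadraticForms

section Energy

variable {F G : Type*} [NormedAddCommGroup F] [InnerProductSpace ℝ F]
  [NormedAddCommGroup G] [InnerProductSpace ℝ G]

theorem metric_growth_le (B : F →L[ℝ] G) {β γ μ T T' : ℝ} (hβ : 0 < β) (hγ : 0 < γ)
    (hTT' : T ^ 2 ≤ T' ^ 2)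
    (h : T' ^ 2 ≤ T ^ 2 + β * μ / (1 + β * γ * ‖B‖ ^ 2) * T) (w : F) :
    T' ^ 2 / (2 * β) * ‖w‖ ^ 2 + γ * T' ^ 2 / 2 * ‖B w‖ ^ 2 ≤
      (T ^ 2 / β + T * μ) / 2 * ‖w‖ ^ 2 + γ * T ^ 2 / 2 * ‖B w‖ ^ 2 := by
  have hden : 0 < 1 + β * γ * ‖B‖ ^ 2 := by positivity
  have h1 : (T' ^ 2 - T ^ 2) * (1 + β * γ * ‖B‖ ^ 2) ≤ β * μ * T := by
    have := mul_le_mul_of_nonneg_right h hden.le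
    have e : (T ^ 2 + β * μ / (1 + β * γ * ‖B‖ ^ 2) * T) * (1 + β * γ * ‖B‖ ^ 2) =
      T ^ 2 * (1 + β * γ * ‖B‖ ^ 2) + β * μ * T := by field_simp
    linarith
  have h2 : ‖B w‖ ^ 2 ≤ ‖B‖ ^ 2 * ‖w‖ ^ 2 := by
    rw [← mul_pow]
    gcongr
    exact B.le_opNorm w
  have h3 : (T' ^ 2 - T ^ 2) * (‖w‖ ^ 2 + β * γ * ‖B w‖ ^ 2) ≤ β * μ * T * ‖w‖ ^ 2 := by
    calc _ ≤ (T' ^ 2 - T ^ 2) * (‖w‖ ^ 2 + β * γ * (‖B‖ ^ 2 * ‖w‖ ^ 2)) := by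
          have := sub_nonneg.2 hTT'
          gcongr
      _ = (T' ^ 2 - T ^ 2) * (1 + β * γ * ‖B‖ ^ 2) * ‖w‖ ^ 2 := by ring
      _ ≤ _ := by gcongr
  rw [← sub_nonneg]
  have e : (T ^ 2 / β + T * μ) / 2 * ‖w‖ ^ 2 + γ * T ^ 2 / 2 * ‖B w‖ ^ 2 -
      (T' ^ 2 / (2 * β) * ‖w‖ ^ 2 + γ * T' ^ 2 / 2 * ‖B w‖ ^ 2) =
      (β * μ * T * ‖w‖ ^ 2 - (T' ^ 2 - T ^ 2) * (‖w‖ ^ 2 + β * γ * ‖B w‖ ^ 2)) / (2 * β) := by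
    field_simp
    ring
  rw [e]
  exact div_nonneg (sub_nonneg.2 h3) (by positivity)

/-- The energy `t k ^ 2 * Δ k + U k` of the scheme stays below its initial value, where the
initial distance `‖z 1‖ ^ 2` is weighted by `t 1 ^ 2` and not by `t 2 ^ 2`. -/
theorem energy_le (B : F →L[ℝ] G) {β γ μ L : ℝ} (hβ : 0 < β) (hγ : 0 < γ) (hμ : 0 < μ)
    {t Δ U : ℕ → ℝ} {w z : ℕ → F} (ht1 : ∀ k ≥ 1, 1 ≤ t k) (htmono : ∀ k ≥ 1, t k ≤ t (k + 1))
    (hβL : β * L ≤ t 1 ^ 2) (htrec : ∀ k ≥ 1, t (k + 1) ^ 2 ≤ t k ^ 2 + t (k + 1))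
    (htrec2 : ∀ k ≥ 1, t (k + 1) ^ 2 ≤ t k ^ 2 + β * μ / (1 + β * γ * ‖B‖ ^ 2) * t k)
    (hΔ : ∀ k, μ / 2 * ‖z k‖ ^ 2 ≤ Δ k) (hwz : w 1 = z 1)
    (hz : ∀ k ≥ 1, t (k + 1) • z (k + 1) = w (k + 1) + (t (k + 1) - 1) • z k)
    (hstep : ∀ k ≥ 1, t (k + 1) ^ 2 * Δ (k + 1) + U (k + 1) +
        (t (k + 1) ^ 2 / β + t (k + 1) * μ) / 2 * ‖w (k + 1)‖ ^ 2 +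
        γ * t (k + 1) ^ 2 / 2 * ‖B (w (k + 1))‖ ^ 2 +
        (t (k + 1) - 1) * (μ / 2) * ‖w (k + 1) - z k‖ ^ 2 +
        (t (k + 1) ^ 2 / β - L) / 2 * ‖w (k + 1) - w k‖ ^ 2 ≤
      t (k + 1) * (t (k + 1) - 1) * Δ k + U k + t (k + 1) ^ 2 / (2 * β) * ‖w k‖ ^ 2 +
        γ * t (k + 1) ^ 2 / 2 * ‖B (w k)‖ ^ 2)
    {k : ℕ} (hk : 1 ≤ k) :
    t k ^ 2 * Δ k + U k ≤ t 1 ^ 2 * Δ 1 + U 1 + t 1 ^ 2 / (2 * β) * ‖z 1‖ ^ 2 +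
      γ * t 2 ^ 2 / 2 * ‖B (z 1)‖ ^ 2 := by
  obtain ⟨C, hC⟩ : ∃ C, C = t 1 ^ 2 * Δ 1 + U 1 + t 1 ^ 2 / (2 * β) * ‖z 1‖ ^ 2 +
      γ * t 2 ^ 2 / 2 * ‖B (z 1)‖ ^ 2 := ⟨_, rfl⟩
  rw [← hC]
  have hτ := ht1 1 le_rfl
  have hτ0 : 0 < t 1 := by linarith
  have h₂ : t 1 ≤ t 2 := htmono 1 le_rfl
  have h₂' : t 2 ^ 2 ≤ t 1 ^ 2 + t 2 := htrec 1 le_rfl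
  have hT20 : 0 < t 2 := by linarith
  have ht2 : ∀ j, t 2 ≤ t (j + 2) := fun j => by
    induction j with
    | zero => rfl
    | succ j ih => exact ih.trans (htmono (j + 2) (by omega))
  obtain ⟨a, ha⟩ : ∃ a, a = t 2 ^ 2 - t 1 ^ 2 := ⟨_, rfl⟩
  have ha0 : 0 ≤ a := by rw [ha]; nlinarith
  have ha2 : a ≤ t 2 := by linarith
  obtain ⟨ν, hν⟩ : ∃ ν, ν = a / (β * t 1) := ⟨_, rfl⟩
  have hν0 : 0 ≤ ν := by rw [hν]; positivity
  have hντ : ν * t 1 = a / β := by rw [hν]; field_simp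
  have hνμ : ν ≤ μ := by
    have h1 : β * μ / (1 + β * γ * ‖B‖ ^ 2) ≤ β * μ := by
      refine div_le_self (by positivity) ?_
      have : 0 ≤ β * γ * ‖B‖ ^ 2 := by positivity
      linarith
    have h2 : a ≤ β * μ * t 1 := by
      have := htrec2 1 le_rfl
      have := mul_le_mul_of_nonneg_right h1 hτ0.le
      norm_num at *
      linarith
    rw [hν, div_le_iff₀ (by positivity)]
    linarith
  have hΔ' : ∀ k, ν / 2 * ‖z k‖ ^ 2 ≤ Δ k := fun k => le_trans (by gcongr) (hΔ k)
  have hL : ∀ T c, t 1 ^ 2 + c ≤ T ^ 2 → c / β ≤ T ^ 2 / β - L := fun T c h => by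
    have h1 : L ≤ t 1 ^ 2 / β := by rw [le_div_iff₀ hβ]; linarith
    have h2 : (t 1 ^ 2 + c) / β ≤ T ^ 2 / β := by gcongr
    rw [add_div] at h2
    linarith
  have inv : ∀ j, ∃ θ, 0 ≤ θ ∧ θ ≤ 1 ∧
      t (j + 2) ^ 2 * Δ (j + 2) + U (j + 2) +
        (t (j + 2) ^ 2 / β + t (j + 2) * μ) / 2 * ‖w (j + 2)‖ ^ 2 +
        γ * t (j + 2) ^ 2 / 2 * ‖B (w (j + 2))‖ ^ 2 +
        ν / 2 * (-(θ * deficitWeight (t 1) (t 2) (t (j + 2))) * ‖z (j + 1)‖ ^ 2 +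
          (t (j + 2) - 1 + θ * ((t 1 + 1) / 2)) * ‖w (j + 2) - z (j + 1)‖ ^ 2) ≤ C := by
    intro j
    induction j with
    | zero =>
      refine ⟨1, zero_le_one, le_rfl, ?_⟩
      have hs := hstep 1 le_rfl
      rw [hwz] at hs
      have h1 := mul_le_mul_of_nonneg_left (hΔ' 1) (sub_nonneg.2 ha2)
      have h2 := mul_le_mul_of_nonneg_right (hL (t 2) a (by linarith))
        (sq_nonneg ‖w 2 - z 1‖)
      have h3 : (t 2 - 1) * (ν / 2) * ‖w 2 - z 1‖ ^ 2 ≤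
          (t 2 - 1) * (μ / 2) * ‖w 2 - z 1‖ ^ 2 := by
        have := sub_nonneg.2 (ht1 2 one_le_two)
        gcongr
      have h4 : ν / 2 * ((t 1 + 1) / 2) * ‖w 2 - z 1‖ ^ 2 ≤ ν / 2 * t 1 * ‖w 2 - z 1‖ ^ 2 := by
        gcongr
        linarith
      have h5 : t 2 ^ 2 / (2 * β) * ‖z 1‖ ^ 2 =
          t 1 ^ 2 / (2 * β) * ‖z 1‖ ^ 2 + a / β / 2 * ‖z 1‖ ^ 2 := by
        rw [ha]; field_simp; ring
      rw [← hντ] at h2 h5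
      have h6 : t 2 * (t 2 - 1) * Δ 1 = t 1 ^ 2 * Δ 1 - (t 2 - a) * Δ 1 := by rw [ha]; ring
      have h7 : deficitWeight (t 1) (t 2) (t 2) = a - (t 2 - t 1) := by
        rw [deficitWeight, ha]; ring
      simp only [zero_add, one_mul, Nat.reduceAdd] at hs ⊢
      rw [h7]
      linarith
    | succ j ih =>
      obtain ⟨θ, hθ0, hθ1, ih⟩ := ih
      have hT := ht2 j
      have hTT' : t (j + 2) ≤ t (j + 3) := htmono (j + 2) (by omega)
      have hT1 : 1 ≤ t (j + 2) := ht1 _ (by omega)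
      have hT0 : 0 < t (j + 2) := by linarith
      have hT'0 : 0 < t (j + 3) := by linarith
      have hsq : t (j + 2) ^ 2 ≤ t (j + 3) ^ 2 := by gcongr
      have hr : t (j + 3) ^ 2 ≤ t (j + 2) ^ 2 + t (j + 3) := htrec (j + 2) (by omega)
      have hs := hstep (j + 2) (by omega)
      have hm := metric_growth_le B hβ hγ hsq (htrec2 (j + 2) (by omega)) (w (j + 2))
      have hzz := hz (j + 1) (by omega)
      obtain ⟨σ, hσ⟩ : ∃ σ, σ = (t (j + 3) ^ 2 - t (j + 2) ^ 2) / t (j + 3) := ⟨_, rfl⟩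
      have hσe : t (j + 3) ^ 2 - t (j + 2) ^ 2 = σ * t (j + 3) := by rw [hσ]; field_simp
      have hσ0 : 0 ≤ σ := by rw [hσ]; exact div_nonneg (sub_nonneg.2 hsq) hT'0.le
      have hσ1 : σ ≤ 1 := by rw [hσ, div_le_one hT'0]; linarith
      refine ⟨θ * σ, by positivity, mul_le_one₀ hθ1 hσ0 hσ1, ?_⟩
      have hS := deficit_step_nonneg hτ h₂ h₂' hT hTT' hσ0 hσ1 hσe (z (j + 2))
        (w (j + 2) - z (j + 1)) (w (j + 3) - z (j + 2))
      have hz1 : z (j + 2) - (1 / t (j + 2)) • (w (j + 2) - z (j + 1)) = z (j + 1) := by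
        apply smul_right_injective F hT0.ne'
        simp only [smul_sub, smul_smul]
        rw [mul_one_div_cancel hT0.ne', one_smul, hzz]
        module
      have hz2 : w (j + 3) - z (j + 2) - (1 - 1 / t (j + 2)) • (w (j + 2) - z (j + 1)) =
          w (j + 3) - w (j + 2) := by
        linear_combination (norm := module) (-1 : ℝ) • hz1
      rw [hz1, hz2] at hS
      have hTa : t 1 ^ 2 + a * (1 + σ) ≤ t (j + 3) ^ 2 := by
        have h1 : t 2 ^ 2 ≤ t (j + 2) ^ 2 := by gcongr
        have h2 : σ * a ≤ σ * t (j + 3) := by gcongr; linarith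
        linarith
      have h1 := mul_le_mul_of_nonneg_left (hΔ' (j + 2))
        (mul_nonneg (sub_nonneg.2 hσ1) hT'0.le)
      have h2 := mul_le_mul_of_nonneg_right (hL _ _ hTa) (sq_nonneg ‖w (j + 3) - w (j + 2)‖)
      have h3 : (t (j + 3) - 1) * (ν / 2) * ‖w (j + 3) - z (j + 2)‖ ^ 2 ≤
          (t (j + 3) - 1) * (μ / 2) * ‖w (j + 3) - z (j + 2)‖ ^ 2 := by
        have := sub_nonneg.2 (hT1.trans hTT')
        gcongr
      have h4 : a * (1 + σ) / β = ν * t 1 * (1 + σ) := by rw [hντ]; ring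
      have h5 : t (j + 3) * (t (j + 3) - 1) * Δ (j + 2) =
          t (j + 2) ^ 2 * Δ (j + 2) - (1 - σ) * t (j + 3) * Δ (j + 2) := by
        have : t (j + 3) * (t (j + 3) - 1) = t (j + 2) ^ 2 - (1 - σ) * t (j + 3) := by linarith
        rw [this]; ring
      have h6 : 0 ≤ (t (j + 2) - 1) * ‖w (j + 2) - z (j + 1)‖ ^ 2 +
          (1 - σ) * t (j + 3) * ‖z (j + 2)‖ ^ 2 +
          t 1 * (1 + σ) * ‖w (j + 3) - w (j + 2)‖ ^ 2 := by
        have := sub_nonneg.2 hT1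
        have := sub_nonneg.2 hσ1
        positivity
      have h7 := mul_nonneg (by positivity : 0 ≤ ν / 2) (add_nonneg (mul_nonneg hθ0 hS)
        (mul_nonneg (sub_nonneg.2 hθ1) h6))
      rw [h4] at h2
      linarith
  obtain ⟨k, rfl⟩ : ∃ j, k = j + 1 := ⟨k - 1, by omega⟩
  rcases k with _ | j
  · have h1 : 0 ≤ t 1 ^ 2 / (2 * β) * ‖z 1‖ ^ 2 := by positivity
    have h2 : 0 ≤ γ * t 2 ^ 2 / 2 * ‖B (z 1)‖ ^ 2 := by positivity
    rw [hC]
    linarith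
  · obtain ⟨θ, hθ0, hθ1, hinv⟩ := inv j
    have hT := ht2 j
    have hT1 : 1 ≤ t (j + 2) := ht1 _ (by omega)
    have hT0 : 0 < t (j + 2) := by linarith
    have hF := deficit_final_nonneg hτ h₂ h₂' hT (z (j + 1)) (w (j + 2) - z (j + 1))
    rw [add_sub_cancel] at hF
    have h1 : 0 ≤ (t (j + 2) - 1) * ‖w (j + 2) - z (j + 1)‖ ^ 2 +
        (t (j + 2) + t (j + 2) ^ 2 * t 1 / t 2) * ‖w (j + 2)‖ ^ 2 := by
      have := sub_nonneg.2 hT1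
      positivity
    have h2 := mul_nonneg (by positivity : 0 ≤ ν / 2) (add_nonneg (mul_nonneg hθ0 hF)
        (mul_nonneg (sub_nonneg.2 hθ1) h1))
    have h3 : ν * (t (j + 2) + t (j + 2) ^ 2 * t 1 / t 2) * ‖w (j + 2)‖ ^ 2 ≤
        (t (j + 2) ^ 2 / β + t (j + 2) * μ) * ‖w (j + 2)‖ ^ 2 := by
      gcongr
      have e : ν * (t (j + 2) + t (j + 2) ^ 2 * t 1 / t 2) =
          t (j + 2) * ν + t (j + 2) ^ 2 / β * (a / t 2) := by
        have : ν * (t (j + 2) ^ 2 * t 1 / t 2) = (ν * t 1) * (t (j + 2) ^ 2 / t 2) := by ring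
        rw [mul_add, this, hντ]
        ring
      have h4 : t (j + 2) ^ 2 / β * (a / t 2) ≤ t (j + 2) ^ 2 / β :=
        mul_le_of_le_one_right (by positivity) ((div_le_one hT20).2 ha2)
      have h5 : t (j + 2) * ν ≤ t (j + 2) * μ := by gcongr
      linarith
    have h4 : 0 ≤ γ * t (j + 2) ^ 2 / 2 * ‖B (w (j + 2))‖ ^ 2 := by positivity
    linarith

end Energy

section Residual

variable {G : Type*} [NormedAddCommGroup G] [NormedSpace ℝ G]

/-- A bound on the scaled residuals `t k ^ 2 • r k` that does not grow with `k`. -/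
theorem norm_sq_smul_residual_le {t : ℕ → ℝ} {r lam : ℕ → G} {c M : ℝ}
    (ht1 : ∀ k ≥ 1, 1 ≤ t k) (htrec : ∀ k ≥ 1, t (k + 1) ^ 2 ≤ t k ^ 2 + t (k + 1))
    (h : ∀ k ≥ 1, t (k + 1) ^ 2 • r (k + 1) =
      (t (k + 1) ^ 2 - t (k + 1)) • r k + c • (lam (k + 1) - lam k))
    (hM : ∀ k ≥ 1, ‖t 1 ^ 2 • r 1 + c • (lam k - lam 1)‖ ≤ M) {k : ℕ} (hk : 1 ≤ k) :
    ‖t k ^ 2 • r k‖ ≤ 2 * M := by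
  have hS : ‖t 1 ^ 2 • r 1 + c • (lam k - lam 1) - t k ^ 2 • r k‖ ≤ M := by
    induction k, hk using Nat.le_induction with
    | base => simpa using (norm_nonneg _).trans (hM 1 le_rfl)
    | succ k hk ih =>
      have htk : 0 < t k := zero_lt_one.trans_le (ht1 k hk)
      have hT : 1 ≤ t (k + 1) := ht1 (k + 1) (by omega)
      obtain ⟨σ, hσ⟩ : ∃ σ, σ = (t k ^ 2 + t (k + 1) - t (k + 1) ^ 2) / t k ^ 2 := ⟨_, rfl⟩
      have hσe : t (k + 1) ^ 2 - t (k + 1) = (1 - σ) * t k ^ 2 := by rw [hσ]; field_simp; ring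
      have hσ0 : 0 ≤ σ := by
        rw [hσ]
        exact div_nonneg (by linarith [htrec k hk]) (by positivity)
      have hσ1 : 0 ≤ 1 - σ := by
        refine nonneg_of_mul_nonneg_left ?_ (by positivity : 0 < t k ^ 2)
        rw [← hσe]
        nlinarith
      have e : t 1 ^ 2 • r 1 + c • (lam (k + 1) - lam 1) - t (k + 1) ^ 2 • r (k + 1) =
          (1 - σ) • (t 1 ^ 2 • r 1 + c • (lam k - lam 1) - t k ^ 2 • r k) +
            σ • (t 1 ^ 2 • r 1 + c • (lam k - lam 1)) := by
        rw [h k hk, hσe]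
        module
      rw [e]
      refine (norm_add_le _ _).trans ?_
      rw [norm_smul, norm_smul, Real.norm_of_nonneg hσ0, Real.norm_of_nonneg hσ1]
      have h1 := mul_le_mul_of_nonneg_left ih hσ1
      have h2 := mul_le_mul_of_nonneg_left (hM k hk) hσ0
      linarith
  have := norm_sub_le (t 1 ^ 2 • r 1 + c • (lam k - lam 1))
    (t 1 ^ 2 • r 1 + c • (lam k - lam 1) - t k ^ 2 • r k)
  rw [sub_sub_cancel] at this
  linarith [hM k hk]

end Residual

section Extrapolation

variable {V : Type*} [AddCommGroup V] [Module ℝ V] {t : ℕ → ℝ} {x u xbar : ℕ → V}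

theorem smul_succ_eq_of_update (ht1 : ∀ k ≥ 1, 1 ≤ t k)
    (hx : ∀ k ≥ 1, x (k + 1) = (1 / t (k + 1)) • u (k + 1) + ((t (k + 1) - 1) / t (k + 1)) • x k)
    {k : ℕ} (hk : 1 ≤ k) : t (k + 1) • x (k + 1) = u (k + 1) + (t (k + 1) - 1) • x k := by
  have h0 : t (k + 1) ≠ 0 := (zero_lt_one.trans_le (ht1 (k + 1) (by omega))).ne'
  rw [hx k hk, smul_add, smul_smul, smul_smul, mul_one_div_cancel h0, one_smul,
    mul_div_cancel₀ _ h0]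

theorem smul_extrapolation_eq (ht1 : ∀ k ≥ 1, 1 ≤ t k) (h0 : x 0 = x 1) (h1 : u 1 = x 1)
    (hx : ∀ k ≥ 1, x (k + 1) = (1 / t (k + 1)) • u (k + 1) + ((t (k + 1) - 1) / t (k + 1)) • x k)
    (hxbar : ∀ k ≥ 1, xbar k = x k + ((t k - 1) / t (k + 1)) • (x k - x (k - 1)))
    {k : ℕ} (hk : 1 ≤ k) : t (k + 1) • xbar k = u k + (t (k + 1) - 1) • x k := by
  have ht : t (k + 1) ≠ 0 := (zero_lt_one.trans_le (ht1 (k + 1) (by omega))).ne'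
  have hu : (t k - 1) • (x k - x (k - 1)) = u k - x k := by
    obtain ⟨j, rfl⟩ : ∃ j, k = j + 1 := ⟨k - 1, by omega⟩
    rcases j with _ | j
    · simp [h0, h1]
    · have := smul_succ_eq_of_update ht1 hx (k := j + 1) (by omega)
      rw [add_tsub_cancel_right]
      linear_combination (norm := module) this
  rw [hxbar k hk, smul_add, smul_smul, mul_div_cancel₀ _ ht, hu]
  module

end Extrapolation

section Saddle

variable {m n p : ℕ} {f1 f2 : EuclideanSpace ℝ (Fin m) → ℝ} {g1 g2 : EuclideanSpace ℝ (Fin n) → ℝ}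
  {A : EuclideanSpace ℝ (Fin m) →L[ℝ] EuclideanSpace ℝ (Fin p)}
  {B : EuclideanSpace ℝ (Fin n) →L[ℝ] EuclideanSpace ℝ (Fin p)} {b : EuclideanSpace ℝ (Fin p)}
  {xs : EuclideanSpace ℝ (Fin m)} {ys : EuclideanSpace ℝ (Fin n)} {lams : EuclideanSpace ℝ (Fin p)}

theorem feasible_of_Lagr_le
    (h : ∀ l, Lagr f1 f2 g1 g2 A B b xs ys l ≤ Lagr f1 f2 g1 g2 A B b xs ys lams) :
    A xs + B ys = b := by
  have := h (lams + (A xs + B ys - b))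
  rw [Lagr, Lagr, inner_add_left, real_inner_self_eq_norm_sq] at this
  have h0 : ‖A xs + B ys - b‖ ^ 2 = 0 := le_antisymm (by linarith) (sq_nonneg _)
  exact sub_eq_zero.1 (norm_eq_zero.1 (pow_eq_zero_iff two_ne_zero |>.1 h0))

theorem Lagr_sub_eq (hb : A xs + B ys = b) (x : EuclideanSpace ℝ (Fin m))
    (y : EuclideanSpace ℝ (Fin n)) :
    Lagr f1 f2 g1 g2 A B b x y lams - Lagr f1 f2 g1 g2 A B b xs ys lams =
      f1 x + f2 x - (f1 xs + f2 xs) + (g1 y + g2 y - (g1 ys + g2 ys)) +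
        ⟪lams, A x + B y - b⟫ := by
  rw [Lagr, Lagr, hb, sub_self, inner_zero_right]
  ring

theorem sq_le_Lagr_sub {μ : ℝ} (hg1 : StrongConvexOn Set.univ μ g1)
    (hg2 : ConvexOn ℝ Set.univ g2) (hb : A xs + B ys = b)
    (h : ∀ x y, Lagr f1 f2 g1 g2 A B b xs ys lams ≤ Lagr f1 f2 g1 g2 A B b x y lams)
    (x : EuclideanSpace ℝ (Fin m)) (y : EuclideanSpace ℝ (Fin n)) :
    μ / 2 * ‖y - ys‖ ^ 2 ≤
      Lagr f1 f2 g1 g2 A B b x y lams - Lagr f1 f2 g1 g2 A B b xs ys lams := by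
  have hx := sub_nonneg.2 (h x ys)
  rw [Lagr_sub_eq hb, sub_self, add_zero] at hx
  have hin : ∀ x y, ⟪lams, A x + B y - b⟫ =
      ⟪lams, A x + B ys - b⟫ + (⟪lams, B y⟫ - ⟪lams, B ys⟫) := fun x y => by
    rw [← inner_sub_right, ← inner_add_right]
    congr 1
    abel
  have hsc : StrongConvexOn Set.univ μ fun y => g1 y + g2 y + ⟪lams, B y⟫ := by
    have h2 : UniformConvexOn Set.univ (fun _ => 0) g2 := uniformConvexOn_zero.2 hg2
    have h3 : UniformConvexOn Set.univ (fun _ => 0) fun y => ⟪lams, B y⟫ :=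
      uniformConvexOn_zero.2 (((innerSL ℝ lams).comp B).toLinearMap.convexOn convex_univ)
    simpa [StrongConvexOn, Pi.add_def] using (UniformConvexOn.add hg1 h2).add h3
  have hmin : ∀ y, g1 ys + g2 ys + ⟪lams, B ys⟫ ≤ g1 y + g2 y + ⟪lams, B y⟫ := fun y => by
    have := sub_nonneg.2 (h xs y)
    rw [Lagr_sub_eq hb, hin, hb, sub_self, sub_self, inner_zero_right] at this
    linarith
  have hy := hsc.add_sq_le_of_forall_le hmin y
  rw [Lagr_sub_eq hb, hin]
  linarith

end Saddle

/-- Convergence of Algorithm 1 (Theorem 2.2): the accelerated linearized ADMM based on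
Nesterov's first scheme, with `λ̂_{k+1} = λ_{k+1}`. -/
theorem stmt7 {m n p : ℕ}
    (A : EuclideanSpace ℝ (Fin m) →L[ℝ] EuclideanSpace ℝ (Fin p))
    (B : EuclideanSpace ℝ (Fin n) →L[ℝ] EuclideanSpace ℝ (Fin p))
    (b : EuclideanSpace ℝ (Fin p))
    (f1 f2 : EuclideanSpace ℝ (Fin m) → ℝ)
    (g1 g2 : EuclideanSpace ℝ (Fin n) → ℝ)
    (f2' : EuclideanSpace ℝ (Fin m) → EuclideanSpace ℝ (Fin m))
    (g2' : EuclideanSpace ℝ (Fin n) → EuclideanSpace ℝ (Fin n))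
    (Lf2 Lg2 μ : ℝ) (hLf2 : 0 ≤ Lf2) (hLg2 : 0 ≤ Lg2) (hμ : 0 < μ)
    -- Assumption 1.1
    (hf1lsc : LowerSemicontinuous f1) (hf1conv : ConvexOn ℝ Set.univ f1)
    (hf2conv : ConvexOn ℝ Set.univ f2)
    (hf2grad : ∀ x, HasGradientAt f2 (f2' x) x)
    (hf2lip : ∀ x y, ‖f2' x - f2' y‖ ≤ Lf2 * ‖x - y‖)
    (hg1lsc : LowerSemicontinuous g1) (hg1sc : StrongConvexOn Set.univ μ g1)
    (hg2conv : ConvexOn ℝ Set.univ g2)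
    (hg2grad : ∀ y, HasGradientAt g2 (g2' y) y)
    (hg2lip : ∀ x y, ‖g2' x - g2' y‖ ≤ Lg2 * ‖x - y‖)
    -- parameters
    (α β γ : ℝ) (hα : 0 < α) (hβ : 0 < β) (hγ : 0 < γ)
    (t : ℕ → ℝ) (ht1 : ∀ k ≥ 1, 1 ≤ t k) (htmono : ∀ k ≥ 1, t k ≤ t (k + 1))
    (hαle : α ≤ 1 / Lf2) (hβle : β ≤ t 1 ^ 2 / Lg2)
    (htrec : ∀ k ≥ 1, t (k + 1) ^ 2 ≤ t k ^ 2 + t (k + 1))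
    (htrec2 : ∀ k ≥ 1,
      t (k + 1) ^ 2 ≤ t k ^ 2 + β * μ / (1 + β * γ * ‖B‖ ^ 2) * t k)
    -- iterates of Scheme A with λ̂ = λ
    (x u xbar : ℕ → EuclideanSpace ℝ (Fin m))
    (y v ybar : ℕ → EuclideanSpace ℝ (Fin n))
    (lam lambar : ℕ → EuclideanSpace ℝ (Fin p))
    (ξ : ℕ → EuclideanSpace ℝ (Fin m)) (ζ : ℕ → EuclideanSpace ℝ (Fin n))
    (hx0 : x 0 = x 1) (hy0 : y 0 = y 1) (hu1 : u 1 = x 1) (hv1 : v 1 = y 1)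
    (hxbar : ∀ k ≥ 1, xbar k = x k + ((t k - 1) / t (k + 1)) • (x k - x (k - 1)))
    (hybar : ∀ k ≥ 1, ybar k = y k + ((t k - 1) / t (k + 1)) • (y k - y (k - 1)))
    (hξ : ∀ k ≥ 1, ∀ z, f1 (u (k + 1)) + ⟪ξ (k + 1), z - u (k + 1)⟫ ≤ f1 z)
    (hu : ∀ k ≥ 1, u (k + 1) - u k =
      -((α * t (k + 1)) • (ξ (k + 1) + f2' (xbar k) +
        ContinuousLinearMap.adjoint A (lambar (k + 1)))))
    (hζ : ∀ k ≥ 1, ∀ z, g1 (v (k + 1)) + ⟪ζ (k + 1), z - v (k + 1)⟫ ≤ g1 z)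
    (hv : ∀ k ≥ 1, v (k + 1) - v k =
      -((β / t (k + 1)) • (ζ (k + 1) + g2' (ybar k) +
        ContinuousLinearMap.adjoint B (lam (k + 1)))))
    (hxupd : ∀ k ≥ 1, x (k + 1) =
      (1 / t (k + 1)) • u (k + 1) + ((t (k + 1) - 1) / t (k + 1)) • x k)
    (hyupd : ∀ k ≥ 1, y (k + 1) =
      (1 / t (k + 1)) • v (k + 1) + ((t (k + 1) - 1) / t (k + 1)) • y k)
    (hlam : ∀ k ≥ 1, lam (k + 1) =
      lam k + (γ * t (k + 1)) • (A (u (k + 1)) + B (v (k + 1)) - b))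
    (hlambar : ∀ k ≥ 1, lambar (k + 1) =
      lam k + (γ * t (k + 1)) • (A (u (k + 1)) + B (v k) - b))
    -- saddle point
    (xs : EuclideanSpace ℝ (Fin m)) (ys : EuclideanSpace ℝ (Fin n))
    (lams : EuclideanSpace ℝ (Fin p))
    (hsaddle : ∀ xx yy ll,
      Lagr f1 f2 g1 g2 A B b xs ys ll ≤ Lagr f1 f2 g1 g2 A B b xs ys lams ∧
      Lagr f1 f2 g1 g2 A B b xs ys lams ≤ Lagr f1 f2 g1 g2 A B b xx yy lams) :
    -- conclusion
    let E1 : ℝ :=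
      t 1 ^ 2 * (Lagr f1 f2 g1 g2 A B b (x 1) (y 1) lams -
        Lagr f1 f2 g1 g2 A B b xs ys lams) +
      1 / (2 * α) * ‖x 1 - xs‖ ^ 2 + t 1 ^ 2 / (2 * β) * ‖y 1 - ys‖ ^ 2 +
      1 / (2 * γ) * ‖lam 1 - lams‖ ^ 2
    let C1 : ℝ :=
      3 * t 1 ^ 2 * ‖A (x 1) + B (y 1) - b‖ +
        (2 * ‖lam 1 - lams‖ +
          2 * Real.sqrt (2 * γ * E1 + γ ^ 2 * t 2 ^ 2 * ‖B (y 1 - ys)‖ ^ 2)) / γ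
    ∀ k ≥ 1,
      Lagr f1 f2 g1 g2 A B b (x k) (y k) lams - Lagr f1 f2 g1 g2 A B b xs ys lams ≤
        (E1 + γ * t 2 ^ 2 / 2 * ‖B (y 1 - ys)‖ ^ 2) / t k ^ 2 ∧
      ‖A (x k) + B (y k) - b‖ ≤ C1 / t k ^ 2 ∧
      |f1 (x k) + f2 (x k) + g1 (y k) + g2 (y k) -
          (f1 xs + f2 xs + g1 ys + g2 ys)| ≤
        (E1 + γ * t 2 ^ 2 / 2 * ‖B (y 1 - ys)‖ ^ 2 + C1 * ‖lams‖) / t k ^ 2 := by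
  intro E1 C1 k hk
  have hαL : α * Lf2 ≤ 1 := by
    rcases hLf2.eq_or_lt with h | h
    · rw [← h, mul_zero]
      exact zero_le_one
    · exact (le_div_iff₀ h).1 hαle
  have hβL : β * Lg2 ≤ t 1 ^ 2 := by
    rcases hLg2.eq_or_lt with h | h
    · rw [← h, mul_zero]
      exact sq_nonneg _
    · exact (le_div_iff₀ h).1 hβle
  have htk : ∀ k ≥ 1, 0 < t k := fun k hk => zero_lt_one.trans_le (ht1 k hk)
  have hb : A xs + B ys = b := feasible_of_Lagr_le fun l => (hsaddle xs ys l).1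
  have hgrowth := sq_le_Lagr_sub hg1sc hg2conv hb fun x y => (hsaddle x y lams).2
  have hxt {k : ℕ} (hk : 1 ≤ k) := smul_succ_eq_of_update ht1 hxupd hk
  have hyt {k : ℕ} (hk : 1 ≤ k) := smul_succ_eq_of_update ht1 hyupd hk
  obtain ⟨Δ, hΔ⟩ : ∃ Δ : ℕ → ℝ, ∀ k, Δ k =
      Lagr f1 f2 g1 g2 A B b (x k) (y k) lams - Lagr f1 f2 g1 g2 A B b xs ys lams :=
    ⟨_, fun _ => rfl⟩
  have hΔ0 : ∀ k, 0 ≤ Δ k := fun k => by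
    rw [hΔ]
    exact sub_nonneg.2 (hsaddle (x k) (y k) lams).2
  have henergy : ∀ k ≥ 1, t k ^ 2 * Δ k +
      (1 / (2 * α) * ‖u k - xs‖ ^ 2 + 1 / (2 * γ) * ‖lam k - lams‖ ^ 2) ≤
      E1 + γ * t 2 ^ 2 / 2 * ‖B (y 1 - ys)‖ ^ 2 := fun k hk => by
    have := energy_le B hβ hγ hμ (Δ := Δ) (w := fun k => v k - ys) (z := fun k => y k - ys)
      (U := fun k => 1 / (2 * α) * ‖u k - xs‖ ^ 2 + 1 / (2 * γ) * ‖lam k - lams‖ ^ 2)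
      ht1 htmono hβL htrec htrec2 (fun k => by rw [hΔ]; exact hgrowth _ _)
      (by rw [hv1]) (fun k hk => by rw [smul_sub, hyt hk]; module) (fun k hk => by
        have := admm_step_le hf1conv hf2conv hf2grad hf2lip hg1sc hg2conv hg2grad hg2lip A B hα hβ
          hγ (ht1 (k + 1) (by omega)) hαL hb (ls := lams) (hxt hk)
          (smul_extrapolation_eq ht1 hx0 hu1 hxupd hxbar hk) (hyt hk)
          (smul_extrapolation_eq ht1 hy0 hv1 hyupd hybar hk) (hξ k hk) (hζ k hk) (hu k hk)
          (hv k hk) (hlam k hk) (hlambar k hk)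
        rw [← Lagr_sub_eq hb, ← Lagr_sub_eq hb, ← hΔ, ← hΔ] at this
        simp only [sub_sub_sub_cancel_right]
        linarith) hk
    simp only [hΔ 1, hu1] at this
    linarith
  have hlamle : ∀ k ≥ 1, ‖lam k - lams‖ ≤
      Real.sqrt (2 * γ * E1 + γ ^ 2 * t 2 ^ 2 * ‖B (y 1 - ys)‖ ^ 2) := fun k hk => by
    apply Real.le_sqrt_of_sq_le
    have h1 : 1 / (2 * γ) * ‖lam k - lams‖ ^ 2 ≤
        E1 + γ * t 2 ^ 2 / 2 * ‖B (y 1 - ys)‖ ^ 2 := by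
      have h2 : 0 ≤ t k ^ 2 * Δ k := mul_nonneg (sq_nonneg _) (hΔ0 k)
      have h3 : 0 ≤ 1 / (2 * α) * ‖u k - xs‖ ^ 2 := by positivity
      linarith [henergy k hk]
    rw [one_div_mul_eq_div, div_le_iff₀ (by positivity)] at h1
    linarith
  have hres : ‖t k ^ 2 • (A (x k) + B (y k) - b)‖ ≤ C1 := by
    have := norm_sq_smul_residual_le (r := fun k => A (x k) + B (y k) - b) (lam := lam)
      (c := γ⁻¹) (M := t 1 ^ 2 * ‖A (x 1) + B (y 1) - b‖ + (‖lam 1 - lams‖ +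
        Real.sqrt (2 * γ * E1 + γ ^ 2 * t 2 ^ 2 * ‖B (y 1 - ys)‖ ^ 2)) / γ) ht1 htrec
      (fun k hk => by
        have hA := congrArg A (hxt hk)
        have hB := congrArg B (hyt hk)
        simp only [map_add, map_smul] at hA hB
        rw [hlam k hk, add_sub_cancel_left, smul_smul, inv_mul_cancel_left₀ hγ.ne']
        linear_combination (norm := module) t (k + 1) • hA + t (k + 1) • hB)
      (fun k hk => by
        refine (norm_add_le _ _).trans ?_
        rw [norm_smul, norm_smul, Real.norm_of_nonneg (sq_nonneg _),
          Real.norm_of_nonneg (inv_nonneg.2 hγ.le), inv_mul_eq_div]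
        gcongr
        have := norm_sub_le_norm_sub_add_norm_sub (lam k) lams (lam 1)
        rw [norm_sub_rev lams] at this
        linarith [hlamle k hk]) hk
    have h0 : 0 ≤ t 1 ^ 2 * ‖A (x 1) + B (y 1) - b‖ := by positivity
    have hC : C1 = 3 * (t 1 ^ 2 * ‖A (x 1) + B (y 1) - b‖) + 2 * ((‖lam 1 - lams‖ +
        Real.sqrt (2 * γ * E1 + γ ^ 2 * t 2 ^ 2 * ‖B (y 1 - ys)‖ ^ 2)) / γ) := by
      simp only [C1]
      ring
    rw [hC]
    linarith
  rw [norm_smul, Real.norm_of_nonneg (sq_nonneg _)] at hres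
  have htk2 : 0 < t k ^ 2 := pow_pos (htk k hk) 2
  have hgap : Δ k * t k ^ 2 ≤ E1 + γ * t 2 ^ 2 / 2 * ‖B (y 1 - ys)‖ ^ 2 := by
    have h3 : 0 ≤ 1 / (2 * α) * ‖u k - xs‖ ^ 2 + 1 / (2 * γ) * ‖lam k - lams‖ ^ 2 := by positivity
    linarith [henergy k hk]
  rw [← hΔ, le_div_iff₀ htk2, le_div_iff₀ htk2, le_div_iff₀ htk2]
  refine ⟨hgap, by linarith, ?_⟩
  have hobj : f1 (x k) + f2 (x k) + g1 (y k) + g2 (y k) - (f1 xs + f2 xs + g1 ys + g2 ys) =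
      Δ k - ⟪lams, A (x k) + B (y k) - b⟫ := by
    rw [hΔ, Lagr_sub_eq hb]
    ring
  rw [hobj]
  calc |Δ k - ⟪lams, A (x k) + B (y k) - b⟫| * t k ^ 2
      ≤ (Δ k + ‖lams‖ * ‖A (x k) + B (y k) - b‖) * t k ^ 2 := by
        gcongr
        refine (abs_sub _ _).trans ?_
        rw [abs_of_nonneg (hΔ0 k)]
        gcongr
        exact abs_real_inner_le_norm _ _
    _ = Δ k * t k ^ 2 + t k ^ 2 * ‖A (x k) + B (y k) - b‖ * ‖lams‖ := by ring
    _ ≤ _ := by gcongr
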